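/- Let δ ≥ 2 an integer, λ > 0, θ ≥ 0, τ > 0, and let f_*(z) = C e^{u z} with u = (δ^λ - 1)/τ and C = δ^{-λθδ/(δ-1)}... For the linearization T'[f_*](h)(z) = δ exp(τΔ_θ)((f_*^{δ-1}h)(δ^{-1-λ}z)), the functions h_k(z) = f_*(z) p_k(z) with p_k a degree-k polynomial are mapped to f_* times a degree-k polynomial, and the eigenvalue associated to the degree-k component is Λ_k = δ^{kλ - k + 1} for k ∈ ℕ₀. -/

import Mathlib

/-- The operator Δ_θ f = θ f' + z f''. -/
noncomputable def Dop (θ : ℝ) (f : ℂ → ℂ) : ℂ → ℂ :=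
  fun z => (θ : ℂ) * deriv f z + z * deriv (deriv f) z

open Polynomial

/-- The conjugate `e^{-vz} Δ_θ e^{vz}` of `Δ_θ`, acting on polynomials. -/
noncomputable def conjDop (θ v : ℂ) : ℂ[X] →ₗ[ℂ] ℂ[X] where
  toFun p := X * derivative (derivative p) + (C θ + 2 * C v * X) * derivative p +
    (C (θ * v) + C (v ^ 2) * X) * p
  map_add' p q := by simp only [derivative_add]; ring
  map_smul' a p := by simp only [smul_eq_C_mul, derivative_C_mul, RingHom.id_apply]; ring

lemma conjDop_apply (θ v : ℂ) (p : ℂ[X]) :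
    conjDop θ v p = X * derivative (derivative p) + (C θ + 2 * C v * X) * derivative p +
      (C (θ * v) + C (v ^ 2) * X) * p := rfl

lemma hasDerivAt_exp_mul_eval (v : ℂ) (p : ℂ[X]) (z : ℂ) :
    HasDerivAt (fun w => Complex.exp (v * w) * p.eval w)
      (Complex.exp (v * z) * (C v * p + derivative p).eval z) z := by
  have h1 : HasDerivAt (fun w => Complex.exp (v * w)) (Complex.exp (v * z) * v) z := by
    simpa using ((hasDerivAt_id z).const_mul v).cexp
  refine (h1.mul (p.hasDerivAt z)).congr_deriv ?_
  rw [eval_add, eval_mul, eval_C]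
  ring

lemma Dop_exp_mul_eval (θ : ℝ) (v : ℂ) (p : ℂ[X]) :
    Dop θ (fun w => Complex.exp (v * w) * p.eval w) =
      fun w => Complex.exp (v * w) * (conjDop θ v p).eval w := by
  have hd (q : ℂ[X]) : deriv (fun w => Complex.exp (v * w) * q.eval w) =
      fun w => Complex.exp (v * w) * (C v * q + derivative q).eval w :=
    funext fun z => (hasDerivAt_exp_mul_eval v q z).deriv
  funext z
  simp only [Dop, hd]
  simp only [conjDop_apply, derivative_add, derivative_C_mul, eval_add, eval_mul, eval_C, eval_X,
    eval_ofNat]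
  ring

lemma Dop_iterate_exp_mul_eval (θ : ℝ) (v : ℂ) (p : ℂ[X]) (j : ℕ) :
    (Dop θ)^[j] (fun w => Complex.exp (v * w) * p.eval w) =
      fun w => Complex.exp (v * w) * ((conjDop θ v)^[j] p).eval w := by
  induction j with
  | zero => rfl
  | succ j ih => rw [Function.iterate_succ_apply', ih, Dop_exp_mul_eval,
      Function.iterate_succ_apply']

/-- The monic Laguerre-type polynomials with `Δ_θ^j e^{wz} = w^j e^{wz} Q_j(wz)`. -/
noncomputable def laguerreAux (θ : ℂ) : ℕ → ℂ[X]
  | 0 => 1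
  | j + 1 => (C θ + C (j : ℂ) + X) * laguerreAux θ j + X * derivative (laguerreAux θ j)

lemma laguerreAux_succ (θ : ℂ) (j : ℕ) : laguerreAux θ (j + 1) =
    (C θ + C (j : ℂ) + X) * laguerreAux θ j + X * derivative (laguerreAux θ j) := rfl

lemma natDegree_laguerreAux_le (θ : ℂ) (j : ℕ) : (laguerreAux θ j).natDegree ≤ j := by
  induction j with
  | zero => simp [laguerreAux]
  | succ j ih =>
    rw [laguerreAux_succ]
    have hd : (derivative (laguerreAux θ j)).natDegree ≤ j :=
      (natDegree_derivative_le _).trans (by omega)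
    have h1 : (C θ + C (j : ℂ) + X : ℂ[X]).natDegree ≤ 1 := by compute_degree
    have h2 := natDegree_mul_le_of_le h1 ih
    have h3 := natDegree_mul_le_of_le (natDegree_X_le (R := ℂ)) hd
    exact natDegree_add_le_of_degree_le (by omega) (by omega)

lemma coeff_laguerreAux_self (θ : ℂ) (j : ℕ) : (laguerreAux θ j).coeff j = 1 := by
  induction j with
  | zero => simp [laguerreAux]
  | succ j ih =>
    have h : (laguerreAux θ j).coeff (j + 1) = 0 :=
      coeff_eq_zero_of_natDegree_lt (by have := natDegree_laguerreAux_le θ j; omega)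
    rw [laguerreAux_succ, ← C_add, add_mul]
    simp [coeff_derivative, h, ih, -map_add]

lemma laguerreAux_ode (θ : ℂ) (j : ℕ) :
    X * derivative (derivative (laguerreAux θ j)) + (C θ + X) * derivative (laguerreAux θ j) =
      C (j : ℂ) * laguerreAux θ j := by
  induction j with
  | zero => simp [laguerreAux]
  | succ j ih =>
    have ih' := congrArg derivative ih
    rw [laguerreAux_succ]
    set Q := laguerreAux θ j
    simp only [derivative_add, derivative_mul, derivative_C, derivative_X, Nat.cast_succ,
      derivative_one, derivative_zero, C_add, C_1] at ih' ⊢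
    linear_combination X * ih' + (C θ + C (j : ℂ) + X + 1) * ih

lemma conjDop_laguerreAux (θ v : ℂ) (j : ℕ) :
    conjDop θ v (C (v ^ j) * (laguerreAux θ j).comp (C v * X)) =
      C (v ^ (j + 1)) * (laguerreAux θ (j + 1)).comp (C v * X) := by
  have ode := congrArg (fun q : ℂ[X] => q.comp (C v * X)) (laguerreAux_ode θ j)
  rw [laguerreAux_succ, conjDop_apply]
  have hd (a : ℂ) (q : ℂ[X]) :
      derivative (C a * q.comp (C v * X)) = C (a * v) * (derivative q).comp (C v * X) := by
    rw [derivative_C_mul, derivative_comp, derivative_C_mul, derivative_X, mul_one, C_mul]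
    ring
  simp only [hd]
  simp only [add_comp, mul_comp, C_comp, X_comp, C_mul, C_pow] at ode ⊢
  set Q := laguerreAux θ j
  linear_combination C v ^ (j + 1) * ode

lemma conjDop_iterate_laguerreAux (θ v : ℂ) (m j : ℕ) :
    (conjDop θ v)^[j] (C (v ^ m) * (laguerreAux θ m).comp (C v * X)) =
      C (v ^ (m + j)) * (laguerreAux θ (m + j)).comp (C v * X) := by
  induction j with
  | zero => rfl
  | succ j ih => rw [Function.iterate_succ_apply', ih, conjDop_laguerreAux, add_assoc]

/-- The `m`-th time derivative of the evolution
`exp(tΔ_θ) e^{vz} = (1 - tv)^{-θ} exp(vz / (1 - tv))`. -/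
noncomputable def heatEvol (θ v z : ℂ) (m : ℕ) (t : ℂ) : ℂ :=
  (1 - t * v) ^ (-θ) * Complex.exp (v / (1 - t * v) * z) * (v / (1 - t * v)) ^ m *
    (laguerreAux θ m).eval (v / (1 - t * v) * z)

lemma hasDerivAt_heatEvol (θ v z : ℂ) (m : ℕ) {t : ℂ} (ht : 1 - t * v ∈ Complex.slitPlane) :
    HasDerivAt (heatEvol θ v z m) (heatEvol θ v z (m + 1) t) t := by
  have h0 : 1 - t * v ≠ 0 := Complex.slitPlane_ne_zero ht
  have hb : HasDerivAt (fun t => 1 - t * v) (-v) t := by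
    simpa using ((hasDerivAt_id t).mul_const v).const_sub 1
  have hw : HasDerivAt (fun t => v / (1 - t * v)) ((v / (1 - t * v)) ^ 2) t := by
    refine ((hasDerivAt_const t v).div hb h0).congr_deriv ?_
    rw [div_pow]
    ring
  have hc := hb.cpow_const (c := -θ) ht
  have hwz := hw.mul_const z
  have hQ := ((laguerreAux θ m).hasDerivAt (v / (1 - t * v) * z)).comp t hwz
  have hpow : HasDerivAt (fun t => (v / (1 - t * v)) ^ m)
      (m * (v / (1 - t * v)) ^ (m + 1)) t := by
    refine (hw.pow m).congr_deriv ?_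
    rcases m with _ | m
    · simp
    · simp only [Nat.add_sub_cancel]
      ring
  have key := ((hc.mul hwz.cexp).mul hpow).mul hQ
  refine key.congr_deriv ?_
  have hcp : (1 - t * v) ^ (-θ - 1) = (1 - t * v) ^ (-θ) / (1 - t * v) := by
    rw [Complex.cpow_sub _ _ h0, Complex.cpow_one]
  simp only [heatEvol, laguerreAux_succ, hcp, eval_add, eval_mul, eval_C, eval_X,
    Pi.mul_apply, Function.comp_apply]
  ring

lemma hasSum_heatEvol (θ v z : ℂ) (m : ℕ) {t : ℂ} (hv : v ≠ 0) (ht : ‖t * v‖ < 1) :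
    HasSum (fun j : ℕ => t ^ j / j.factorial * heatEvol θ v z (m + j) 0)
      (heatEvol θ v z m t) := by
  have hvpos : 0 < ‖v‖ := norm_pos_iff.2 hv
  have hslit {x : ℂ} (hx : x ∈ Metric.ball (0 : ℂ) ‖v‖⁻¹) : 1 - x * v ∈ Complex.slitPlane := by
    rw [mem_ball_zero_iff, ← one_div, lt_div_iff₀ hvpos, ← norm_mul] at hx
    left
    have := (Complex.re_le_norm (x * v)).trans_lt hx
    simpa using this
  have hder (j : ℕ) : ∀ x ∈ Metric.ball (0 : ℂ) ‖v‖⁻¹,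
      iteratedDeriv j (heatEvol θ v z m) x = heatEvol θ v z (m + j) x := by
    induction j with
    | zero => simp
    | succ j ih =>
      intro x hx
      rw [iteratedDeriv_succ]
      have he : iteratedDeriv j (heatEvol θ v z m) =ᶠ[nhds x] heatEvol θ v z (m + j) :=
        Filter.eventually_of_mem (Metric.isOpen_ball.mem_nhds hx) ih
      rw [he.deriv_eq]
      exact (hasDerivAt_heatEvol θ v z (m + j) (hslit hx)).deriv
  have hdiff : DifferentiableOn ℂ (heatEvol θ v z m) (Metric.ball 0 ‖v‖⁻¹) := fun x hx =>
    (hasDerivAt_heatEvol θ v z m (hslit hx)).differentiableAt.differentiableWithinAt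
  have htb : t ∈ Metric.ball (0 : ℂ) ‖v‖⁻¹ := by
    rwa [mem_ball_zero_iff, ← one_div, lt_div_iff₀ hvpos, ← norm_mul]
  have h := Complex.hasSum_taylorSeries_on_ball hdiff htb
  refine h.congr_fun ?_
  intro j
  rw [hder j 0 (Metric.mem_ball_self (inv_pos.2 hvpos))]
  simp only [sub_zero, smul_eq_mul]
  ring

lemma coeff_laguerreAux_comp_self (θ a : ℂ) (k : ℕ) :
    ((laguerreAux θ k).comp (C a * X)).coeff k = a ^ k := by
  rw [comp_C_mul_X_coeff, coeff_laguerreAux_self, one_mul]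

lemma natDegree_comp_C_mul_X_le {p : ℂ[X]} {k : ℕ} (hp : p.natDegree ≤ k) (a : ℂ) :
    (p.comp (C a * X)).natDegree ≤ k := by
  refine natDegree_comp_le.trans ((Nat.mul_le_mul hp ((natDegree_C_mul_le a X).trans natDegree_X_le)).trans ?_)
  simp

lemma hasSum_of_eq {f g : ℕ → ℂ} {a b : ℂ} (h : HasSum f a) (hfg : ∀ j, g j = f j)
    (hab : b = a) : HasSum g b := by
  rwa [hab, funext hfg]

/-- `exp(tΔ_θ)` maps `e^{vz} p(z)` to `(1 - tv)^{-θ} e^{vz/(1-tv)} r(z)`, with `deg r ≤ deg p`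
and top coefficient multiplied by `(1 - tv)^{-2k}`. -/
lemma exists_hasSum_conjDop (θ v t : ℂ) (hv : v ≠ 0) (ht : ‖t * v‖ < 1) (k : ℕ) :
    ∀ p : ℂ[X], p.natDegree ≤ k → ∃ r : ℂ[X], r.natDegree ≤ k ∧
      r.coeff k = ((1 - t * v) ^ (2 * k))⁻¹ * p.coeff k ∧
      ∀ z, HasSum (fun j : ℕ => t ^ j / j.factorial *
          (Complex.exp (v * z) * ((conjDop θ v)^[j] p).eval z))
        ((1 - t * v) ^ (-θ) * Complex.exp (v / (1 - t * v) * z) * r.eval z) := by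
  have h0 : 1 - t * v ≠ 0 := fun h => by
    rw [← sub_eq_zero.1 h] at ht
    simp at ht
  have basis (m : ℕ) (a z : ℂ) : HasSum (fun j : ℕ => t ^ j / j.factorial *
        (Complex.exp (v * z) * ((conjDop θ v)^[j]
          (C a * (C (v ^ m) * (laguerreAux θ m).comp (C v * X)))).eval z))
      ((1 - t * v) ^ (-θ) * Complex.exp (v / (1 - t * v) * z) *
        (C (a * (v / (1 - t * v)) ^ m) *
          (laguerreAux θ m).comp (C (v / (1 - t * v)) * X)).eval z) := by
    refine hasSum_of_eq ((hasSum_heatEvol θ v z m hv ht).mul_left a) (fun j => ?_) ?_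
    · rw [← smul_eq_C_mul, ← Module.End.pow_apply, map_smul, Module.End.pow_apply,
        conjDop_iterate_laguerreAux]
      simp [heatEvol]
      ring
    · simp [heatEvol]
      ring
  have step (k : ℕ) (p : ℂ[X]) (a : ℂ) (ha : a * v ^ (2 * k) = p.coeff k) :
      (C (a * (v / (1 - t * v)) ^ k) *
        (laguerreAux θ k).comp (C (v / (1 - t * v)) * X)).coeff k =
      ((1 - t * v) ^ (2 * k))⁻¹ * p.coeff k := by
    rw [coeff_C_mul, coeff_laguerreAux_comp_self, ← ha, div_pow, two_mul, pow_add, pow_add]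
    field_simp
  induction k with
  | zero =>
    intro p hp
    refine ⟨_, ?_, step 0 p (p.coeff 0) (by simp), fun z => ?_⟩
    · exact (natDegree_C_mul_le _ _).trans
        (natDegree_comp_C_mul_X_le (natDegree_laguerreAux_le θ 0) _)
    · have hC : C (p.coeff 0) * (C (v ^ 0) * (laguerreAux θ 0).comp (C v * X)) = p := by
        conv_rhs => rw [eq_C_of_natDegree_le_zero hp]
        simp [laguerreAux]
      simpa only [hC] using basis 0 (p.coeff 0) z
  | succ k ih =>
    intro p hp
    set a := p.coeff (k + 1) / v ^ (2 * (k + 1)) with ha_def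
    have ha : a * v ^ (2 * (k + 1)) = p.coeff (k + 1) := div_mul_cancel₀ _ (pow_ne_zero _ hv)
    set B := C a * (C (v ^ (k + 1)) * (laguerreAux θ (k + 1)).comp (C v * X)) with hB
    have hBdeg : B.natDegree ≤ k + 1 := (natDegree_C_mul_le _ _).trans <|
      (natDegree_C_mul_le _ _).trans
        (natDegree_comp_C_mul_X_le (natDegree_laguerreAux_le θ (k + 1)) _)
    have hBcoeff : B.coeff (k + 1) = p.coeff (k + 1) := by
      rw [hB, coeff_C_mul, coeff_C_mul, coeff_laguerreAux_comp_self, ← ha]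
      ring
    have hlow : (p - B).natDegree ≤ k := by
      rw [natDegree_le_iff_coeff_eq_zero]
      intro N hN
      rcases (Nat.succ_le_of_lt hN).eq_or_lt with h | h
      · rw [← h, coeff_sub, hBcoeff, sub_self]
      · rw [coeff_sub, coeff_eq_zero_of_natDegree_lt (hp.trans_lt h),
          coeff_eq_zero_of_natDegree_lt (hBdeg.trans_lt h), sub_self]
    obtain ⟨r, hr, -, hsum⟩ := ih (p - B) hlow
    refine ⟨r + C (a * (v / (1 - t * v)) ^ (k + 1)) *
        (laguerreAux θ (k + 1)).comp (C (v / (1 - t * v)) * X), ?_, ?_, fun z => ?_⟩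
    · exact natDegree_add_le_of_degree_le (by omega) ((natDegree_C_mul_le _ _).trans
        (natDegree_comp_C_mul_X_le (natDegree_laguerreAux_le θ (k + 1)) _))
    · rw [coeff_add, step (k + 1) p a ha, coeff_eq_zero_of_natDegree_lt (by omega), zero_add]
    · refine hasSum_of_eq ((hsum z).add (basis (k + 1) a z)) (fun j => ?_) ?_
      · rw [← hB]
        simp only [← Module.End.pow_apply, map_sub, eval_sub]
        ring
      · rw [eval_add]
        ring

/-- The linearization T'[f_*](h)(z) = δ exp(τΔ_θ)((f_*^{δ-1}h)(δ^{-1-λ}z)) at the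
nontrivial fixed point f_*(z) = δ^{-λθ/(δ-1)} e^{(δ^λ-1)z/τ} maps h_k = f_* p_k
(p_k a degree-k polynomial) to f_* times a degree-≤k polynomial whose degree-k
coefficient is multiplied by the eigenvalue Λ_k = δ^{kλ-k+1}. -/
theorem stmt14 (θ τ lam : ℝ) (δ : ℕ) (hθ : 0 ≤ θ) (hτ : 0 < τ) (hlam : 0 < lam)
    (hδ : 2 ≤ δ) (fstar : ℂ → ℂ)
    (hfstar : ∀ z, fstar z = (((δ : ℝ) ^ (-(lam * θ) / ((δ : ℝ) - 1)) : ℝ) : ℂ) *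
        Complex.exp (((((δ : ℝ) ^ lam - 1) / τ : ℝ) : ℂ) * z))
    (k : ℕ) (p : Polynomial ℂ) (hp : p.natDegree = k) :
    ∃ q : Polynomial ℂ, q.natDegree ≤ k ∧
      q.coeff k = (((δ : ℝ) ^ ((k : ℝ) * lam - (k : ℝ) + 1) : ℝ) : ℂ) * p.coeff k ∧
      ∀ z : ℂ,
        (δ : ℂ) * ∑' j : ℕ, ((τ ^ j / j.factorial : ℝ) : ℂ) *
          (Dop θ)^[j]
            (fun w => (fstar (w * (((δ : ℝ) ^ (-(1 + lam)) : ℝ) : ℂ))) ^ (δ - 1) *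
              (fstar (w * (((δ : ℝ) ^ (-(1 + lam)) : ℝ) : ℂ)) *
                p.eval (w * (((δ : ℝ) ^ (-(1 + lam)) : ℝ) : ℂ)))) z
          = fstar z * q.eval z := by
  have hD : (0 : ℝ) < δ := by positivity
  have hD1 : (1 : ℝ) < δ := by exact_mod_cast hδ
  set s : ℝ := (δ : ℝ) ^ lam with hs
  set a : ℝ := (δ : ℝ) ^ (-(lam * θ) / ((δ : ℝ) - 1)) with ha
  set c : ℝ := (δ : ℝ) ^ (-(1 + lam)) with hc
  have hs1 : 1 < s := Real.one_lt_rpow hD1 hlam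
  have hs0 : 0 < s := by positivity
  have ha0 : 0 < a := Real.rpow_pos_of_pos hD _
  have hc_eq : c = (δ * s)⁻¹ := by
    rw [hc, Real.rpow_neg hD.le, Real.rpow_add hD, Real.rpow_one]
  have hinv : s⁻¹ < 1 := inv_lt_one_of_one_lt₀ hs1
  have hinv0 : 0 < s⁻¹ := inv_pos.2 hs0
  set v : ℝ := (1 - s⁻¹) / τ with hv
  have hv0 : 0 < v := div_pos (by linarith) hτ
  have hτv : τ * v = 1 - s⁻¹ := by rw [hv]; field_simp
  have h1 : (1 : ℂ) - (τ : ℂ) * (v : ℂ) = ((s⁻¹ : ℝ) : ℂ) := by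
    rw [← Complex.ofReal_mul, hτv]
    push_cast
    ring
  have hvs : (v : ℂ) / ((s⁻¹ : ℝ) : ℂ) = (((s - 1) / τ : ℝ) : ℂ) := by
    rw [← Complex.ofReal_div, hv]
    congr 1
    field_simp
  have hnorm : ‖(τ : ℂ) * (v : ℂ)‖ < 1 := by
    rw [← Complex.ofReal_mul, hτv, Complex.norm_real, Real.norm_eq_abs, abs_lt]
    constructor <;> linarith
  have hpow : ((s⁻¹ : ℝ) : ℂ) ^ (-(θ : ℂ)) = ((s ^ θ : ℝ) : ℂ) := by
    rw [← Complex.ofReal_neg, ← Complex.ofReal_cpow hinv0.le, Real.inv_rpow hs0.le,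
      Real.rpow_neg hs0.le, inv_inv]
  have hanorm : a ^ (δ - 1) * s ^ θ = 1 := by
    rw [ha, hs, ← Real.rpow_natCast, ← Real.rpow_mul hD.le, ← Real.rpow_mul hD.le,
      ← Real.rpow_add hD, Nat.cast_sub (by omega), Nat.cast_one,
      div_mul_cancel₀ _ (by linarith), neg_add_cancel, Real.rpow_zero]
  have hΛ : (δ : ℝ) ^ ((k : ℝ) * lam - k + 1) = δ * s ^ (2 * k) * c ^ k := by
    rw [Real.rpow_add hD, Real.rpow_sub hD, Real.rpow_one, Real.rpow_natCast, mul_comm (k : ℝ),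
      Real.rpow_mul hD.le, Real.rpow_natCast, ← hs, hc_eq, two_mul, pow_add, inv_pow, mul_pow]
    field_simp
  have hfun : (fun w => (fstar (w * (c : ℂ))) ^ (δ - 1) *
      (fstar (w * (c : ℂ)) * p.eval (w * (c : ℂ)))) =
      fun w => Complex.exp ((v : ℂ) * w) *
        (C (((a ^ δ : ℝ)) : ℂ) * p.comp (C (c : ℂ) * X)).eval w := by
    funext w
    have hexp : (v : ℂ) * w = (δ : ℕ) * ((((s - 1) / τ : ℝ) : ℂ) * (w * (c : ℂ))) := by
      have : v = δ * ((s - 1) / τ * c) := by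
        rw [hv, hc_eq]
        field_simp
      rw [this]
      push_cast
      ring
    rw [← mul_assoc, pow_sub_one_mul (by omega), hfstar, mul_pow, ← Complex.exp_nat_mul, ← hexp]
    simp only [eval_mul, eval_C, eval_comp, eval_X, Complex.ofReal_pow, mul_comm (c : ℂ) w]
    ring
  have hdeg : (C (((a ^ δ : ℝ)) : ℂ) * p.comp (C (c : ℂ) * X)).natDegree ≤ k :=
    (natDegree_C_mul_le _ _).trans (natDegree_comp_C_mul_X_le hp.le _)
  obtain ⟨r, hr, hrk, hsum⟩ := exists_hasSum_conjDop (θ : ℂ) (v : ℂ) (τ : ℂ)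
    (Complex.ofReal_ne_zero.2 hv0.ne') hnorm k _ hdeg
  have haC : (a : ℂ) ≠ 0 := Complex.ofReal_ne_zero.2 ha0.ne'
  refine ⟨C (((δ * s ^ θ / a : ℝ)) : ℂ) * r, (natDegree_C_mul_le _ _).trans hr, ?_, fun z => ?_⟩
  · rw [coeff_C_mul, hrk, h1, coeff_C_mul, comp_C_mul_X_coeff, hΛ]
    have hreal : δ * s ^ θ / a * ((s⁻¹) ^ (2 * k))⁻¹ * a ^ δ * c ^ k =
        δ * s ^ (2 * k) * c ^ k := by
      rw [← pow_sub_one_mul (by omega : δ ≠ 0) a, inv_pow, inv_inv]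
      field_simp
      linear_combination c ^ k * hanorm
    rw [← hreal]
    push_cast
    ring
  · rw [hfun]
    simp only [Dop_iterate_exp_mul_eval]
    have hz := (hsum z).tsum_eq
    rw [h1, hvs, hpow] at hz
    have hcast (j : ℕ) : ((τ ^ j / j.factorial : ℝ) : ℂ) = (τ : ℂ) ^ j / j.factorial := by
      push_cast
      rfl
    simp only [hcast]
    rw [hz, hfstar, eval_mul, eval_C]
    push_cast
    field_simp
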